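/- arXiv:1706.06249 — 5 statements merged into one kernel-verified Lean document; each statement's English description precedes it below -/
import Mathlib

section
/- Let $k>0$, $T>0$, and let $b\in C^1((0,T])$ satisfy $\lim_{t\to 0^+}b(t)=0$ and $b'(t)>0$ for all $t\in(0,T]$. Define $\beta(t)=1-\frac{2k}{b(t)e^{2kt}}\int_0^t b(s)e^{2ks}\,ds$. Then $\beta(t)\ge 1-2kt$ for all $t\in(0,T]$; in particular $\lim_{t\to 0^+}\beta(t)=1$. -/
open Real Set Filter MeasureTheory

/-- A function on `(a, T]` with positive derivative is strictly increasing there. -/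
theorem strictMonoOn_Ioc_of_derivWithin_pos {a T : ℝ} {b : ℝ → ℝ}
    (hb : DifferentiableOn ℝ b (Ioc a T))
    (hb' : ∀ t ∈ Ioc a T, 0 < derivWithin b (Ioc a T) t) :
    StrictMonoOn b (Ioc a T) := by
  refine strictMonoOn_of_deriv_pos (convex_Ioc a T) hb.continuousOn fun x hx => ?_
  rw [← derivWithin_of_mem_nhds (mem_interior_iff_mem_nhds.1 hx)]
  exact hb' x (interior_subset hx)

/-- A strictly increasing function on `(a, T]` is larger than its right limit at `a`. -/
theorem StrictMonoOn.lt_of_tendsto_nhdsGT {a T l : ℝ} {b : ℝ → ℝ}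
    (hb : StrictMonoOn b (Ioc a T)) (hl : Tendsto b (nhdsWithin a (Ioi a)) (nhds l))
    {t : ℝ} (ht : t ∈ Ioc a T) : l < b t := by
  obtain ⟨u, hau, hut⟩ := exists_between ht.1
  have hu : u ∈ Ioc a T := ⟨hau, hut.le.trans ht.2⟩
  refine lt_of_le_of_lt (le_of_tendsto hl ?_) (hb hu ht hut)
  filter_upwards [Ioc_mem_nhdsGT hau] with s hs
  exact hb.monotoneOn ⟨hs.1, hs.2.trans hu.2⟩ hu hs.2

/-- The exponentially weighted integral of a nonnegative increasing function over `(0, t]` is at most `t` times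
the final value of the integrand. -/
theorem abs_integral_mul_exp_le {c t : ℝ} {b : ℝ → ℝ} (hc : 0 ≤ c) (ht : 0 ≤ t)
    (hb : MonotoneOn b (Ioc 0 t)) (hb0 : ∀ s ∈ Ioc 0 t, 0 ≤ b s) :
    |∫ s in (0:ℝ)..t, b s * Real.exp (c * s)| ≤ b t * Real.exp (c * t) * t := by
  have h := intervalIntegral.norm_integral_le_of_norm_le_const (a := 0) (b := t)
    (f := fun s => b s * Real.exp (c * s)) (C := b t * Real.exp (c * t)) fun s hs => by
      rw [uIoc_of_le ht] at hs
      have htt : t ∈ Ioc 0 t := ⟨hs.1.trans_le hs.2, le_rfl⟩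
      have hst := hb hs htt hs.2
      rw [Real.norm_of_nonneg (mul_nonneg (hb0 s hs) (Real.exp_pos _).le)]
      exact mul_le_mul hst (Real.exp_le_exp.2 (mul_le_mul_of_nonneg_left hs.2 hc))
        (Real.exp_pos _).le (hb0 t htt)
  rwa [sub_zero, abs_of_nonneg ht, Real.norm_eq_abs] at h

/-- If `b ∈ C¹((0,T])` with `b(0⁺)=0` and `b' > 0`, and
`β(t) = 1 - (2k/(b(t)e^{2kt})) ∫₀ᵗ b(s)e^{2ks} ds`, then `β(t) ≥ 1 - 2kt` on `(0,T]`;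
in particular `β(t) → 1` as `t → 0⁺`. -/
theorem beta_lower_bound_and_limit_one (k T : ℝ) (hk : 0 < k) (hT : 0 < T) (b β : ℝ → ℝ)
    (hb_diff : ∀ t ∈ Ioc (0:ℝ) T, DifferentiableWithinAt ℝ b (Ioc (0:ℝ) T) t)
    (hb_cont : ContinuousOn (derivWithin b (Ioc (0:ℝ) T)) (Ioc (0:ℝ) T))
    (hb'_pos : ∀ t ∈ Ioc (0:ℝ) T, 0 < derivWithin b (Ioc (0:ℝ) T) t)
    (hb0 : Tendsto b (nhdsWithin 0 (Ioi 0)) (nhds 0))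
    (hβ : ∀ t, β t = 1 - (2 * k / (b t * Real.exp (2 * k * t))) *
      ∫ s in (0:ℝ)..t, b s * Real.exp (2 * k * s)) :
    (∀ t ∈ Ioc (0:ℝ) T, 1 - 2 * k * t ≤ β t) ∧
      Tendsto β (nhdsWithin 0 (Ioi 0)) (nhds 1) := by
  have hmono := strictMonoOn_Ioc_of_derivWithin_pos hb_diff hb'_pos
  have hpos : ∀ t ∈ Ioc (0:ℝ) T, 0 < b t := fun t ht => hmono.lt_of_tendsto_nhdsGT hb0 ht
  have hbound : ∀ t ∈ Ioc (0:ℝ) T, |β t - 1| ≤ 2 * k * t := fun t ht => by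
    have hsub : Ioc 0 t ⊆ Ioc 0 T := Ioc_subset_Ioc_right ht.2
    have hI := abs_integral_mul_exp_le (c := 2 * k) (by positivity) ht.1.le
      (hmono.monotoneOn.mono hsub) fun s hs => (hpos s (hsub hs)).le
    have hden : 0 < b t * Real.exp (2 * k * t) := mul_pos (hpos t ht) (Real.exp_pos _)
    rw [hβ t, sub_sub_cancel_left, abs_neg, abs_mul,
      abs_of_pos (div_pos (by positivity) hden), div_mul_eq_mul_div, div_le_iff₀ hden]
    calc 2 * k * |∫ s in (0:ℝ)..t, b s * Real.exp (2 * k * s)|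
        ≤ 2 * k * (b t * Real.exp (2 * k * t) * t) := by gcongr
      _ = 2 * k * t * (b t * Real.exp (2 * k * t)) := by ring
  refine ⟨fun t ht => by linarith [(abs_le.1 (hbound t ht)).1], ?_⟩
  have hlin : Tendsto (fun t : ℝ => 2 * k * t) (nhdsWithin 0 (Ioi 0)) (nhds 0) := by
    simpa using ((continuous_const_mul (2 * k)).tendsto 0).mono_left nhdsWithin_le_nhds
  rw [tendsto_iff_norm_sub_tendsto_zero]
  refine squeeze_zero' (Eventually.of_forall fun _ => norm_nonneg _) ?_ hlin
  filter_upwards [Ioc_mem_nhdsGT hT] with t ht using hbound t ht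
end

section
/- Let $k>0$, $T>0$, $\delta\in(0,1)$, and let $b\in C^1((0,T])$ satisfy $\lim_{t\to 0^+}b(t)=0$ and $b'(t)>0$ for all $t\in(0,T]$. Define $\beta(t)=1-\frac{2k}{b(t)e^{2kt}}\int_0^t b(s)e^{2ks}\,ds$ and $\lambda(t)=b(t)^{1-\delta}$. Then for all $t\in(0,T]$, $\frac{2k\beta(t)+\beta'(t)}{1-\beta(t)}-(1+\delta)\,\frac{\lambda'(t)}{\lambda(t)}=\delta^2\,\frac{b'(t)}{b(t)}>0$. -/
open Real Set Filter MeasureTheory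

/-- A function on `(0, T]` with positive derivative and limit `0` at `0` is positive. -/
theorem pos_of_derivWithin_pos_of_tendsto_zero {b : ℝ → ℝ} {T : ℝ}
    (hb_diff : ∀ t ∈ Ioc (0:ℝ) T, DifferentiableWithinAt ℝ b (Ioc (0:ℝ) T) t)
    (hb'_pos : ∀ t ∈ Ioc (0:ℝ) T, 0 < derivWithin b (Ioc (0:ℝ) T) t)
    (hb0 : Tendsto b (nhdsWithin 0 (Ioi 0)) (nhds 0)) :
    ∀ t ∈ Ioc (0:ℝ) T, 0 < b t := by
  have hmono : StrictMonoOn b (Ioc 0 T) := by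
    refine strictMonoOn_of_deriv_pos (convex_Ioc 0 T)
      (fun t ht => (hb_diff t ht).continuousWithinAt) fun t ht => ?_
    rw [← derivWithin_of_mem_nhds (mem_interior_iff_mem_nhds.1 ht)]
    exact hb'_pos t (interior_subset ht)
  have hnonneg : ∀ t ∈ Ioc (0:ℝ) T, 0 ≤ b t := fun t ht => by
    refine le_of_tendsto hb0 ?_
    filter_upwards [Ioc_mem_nhdsGT ht.1] with s hs
    exact hmono.monotoneOn ⟨hs.1, hs.2.trans ht.2⟩ ht hs.2
  intro t ht
  have ht2 : t / 2 ∈ Ioc (0:ℝ) T := ⟨by linarith [ht.1], by linarith [ht.1, ht.2]⟩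
  exact (hnonneg _ ht2).trans_lt (hmono ht2 ht (by linarith [ht.1]))

/-- A function continuous on `(0, T]` with a right limit at `0` is integrable on `[0, t]`
for every `t ∈ (0, T]`. -/
theorem intervalIntegrable_of_continuousOn_Ioc_of_tendsto {f : ℝ → ℝ} {T l : ℝ}
    (hf : ContinuousOn f (Ioc 0 T)) (h0 : Tendsto f (nhdsWithin 0 (Ioi 0)) (nhds l))
    {t : ℝ} (ht : t ∈ Ioc (0:ℝ) T) : IntervalIntegrable f volume 0 t := by
  have hc : ContinuousOn (Function.update f 0 l) (Icc 0 t) := by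
    rw [continuousOn_update_iff, Icc_sdiff_left]
    exact ⟨hf.mono (Ioc_subset_Ioc_right ht.2),
      fun _ => h0.mono_left (nhdsWithin_mono 0 Ioc_subset_Ioi_self)⟩
  refine (hc.intervalIntegrable_of_Icc ht.1.le).congr fun s hs => ?_
  rw [uIoc_of_le ht.1.le] at hs
  exact Function.update_of_ne hs.1.ne' _ _

/-- The fundamental theorem of calculus on `(0, T]`, for a continuous function with a
right limit at `0`. -/
theorem hasDerivWithinAt_integral_Ioc {f : ℝ → ℝ} {T l : ℝ}
    (hf : ContinuousOn f (Ioc 0 T)) (h0 : Tendsto f (nhdsWithin 0 (Ioi 0)) (nhds l))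
    {t : ℝ} (ht : t ∈ Ioc (0:ℝ) T) :
    HasDerivWithinAt (fun u => ∫ s in (0:ℝ)..u, f s) (f t) (Ioc 0 T) t := by
  have hmem : Ioc 0 T ∈ nhdsWithin t (Icc 0 T) := by
    filter_upwards [self_mem_nhdsWithin, mem_nhdsWithin_of_mem_nhds (Ioi_mem_nhds ht.1)]
      with s hs hs'
    exact ⟨hs', hs.2⟩
  have : Fact (t ∈ Icc 0 T) := ⟨Ioc_subset_Icc_self ht⟩
  exact (intervalIntegral.integral_hasDerivWithinAt_right (s := Icc 0 T) (t := Icc 0 T)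
    (intervalIntegrable_of_continuousOn_Ioc_of_tendsto hf h0 ht)
    ⟨_, hmem, hf.aestronglyMeasurable measurableSet_Ioc⟩
    ((hf t ht).mono_of_mem_nhdsWithin hmem)).mono Ioc_subset_Icc_self

/-- With `b ∈ C¹((0,T])`, `b(0⁺)=0`, `b' > 0`, `δ ∈ (0,1)`,
`β(t) = 1 - (2k/(b(t)e^{2kt})) ∫₀ᵗ b(s)e^{2ks} ds` and `λ(t) = b(t)^{1-δ}`, one has
`(2kβ+β')/(1-β) - (1+δ) λ'/λ = δ² b'/b > 0` on `(0,T]`. -/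
theorem beta_lambda_identity (k T δ : ℝ) (hk : 0 < k) (hT : 0 < T)
    (hδ : δ ∈ Ioo (0:ℝ) 1) (b β lam : ℝ → ℝ)
    (hb_diff : ∀ t ∈ Ioc (0:ℝ) T, DifferentiableWithinAt ℝ b (Ioc (0:ℝ) T) t)
    (hb_cont : ContinuousOn (derivWithin b (Ioc (0:ℝ) T)) (Ioc (0:ℝ) T))
    (hb'_pos : ∀ t ∈ Ioc (0:ℝ) T, 0 < derivWithin b (Ioc (0:ℝ) T) t)
    (hb0 : Tendsto b (nhdsWithin 0 (Ioi 0)) (nhds 0))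
    (hβ : ∀ t, β t = 1 - (2 * k / (b t * Real.exp (2 * k * t))) *
      ∫ s in (0:ℝ)..t, b s * Real.exp (2 * k * s))
    (hlam : ∀ t, lam t = b t ^ (1 - δ)) :
    ∀ t ∈ Ioc (0:ℝ) T,
      (2 * k * β t + derivWithin β (Ioc (0:ℝ) T) t) / (1 - β t)
          - (1 + δ) * (derivWithin lam (Ioc (0:ℝ) T) t / lam t)
        = δ ^ 2 * (derivWithin b (Ioc (0:ℝ) T) t / b t) ∧
      0 < δ ^ 2 * (derivWithin b (Ioc (0:ℝ) T) t / b t) := by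
  have hpos := pos_of_derivWithin_pos_of_tendsto_zero hb_diff hb'_pos hb0
  intro t ht
  have hbt := hpos t ht
  have hexp : Continuous fun s => Real.exp (2 * k * s) := by fun_prop
  have hf : ContinuousOn (fun s => b s * Real.exp (2 * k * s)) (Ioc 0 T) :=
    ContinuousOn.mul (fun s hs => (hb_diff s hs).continuousWithinAt) hexp.continuousOn
  have hf0 : Tendsto (fun s => b s * Real.exp (2 * k * s)) (nhdsWithin 0 (Ioi 0))
      (nhds (0 * Real.exp (2 * k * 0))) :=
    hb0.mul ((hexp.tendsto 0).mono_left nhdsWithin_le_nhds)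
  have hI := hasDerivWithinAt_integral_Ioc hf hf0 ht
  have hIpos : 0 < ∫ s in (0:ℝ)..t, b s * Real.exp (2 * k * s) :=
    intervalIntegral.intervalIntegral_pos_of_pos_on
      (intervalIntegrable_of_continuousOn_Ioc_of_tendsto hf hf0 ht)
      (fun s hs => mul_pos (hpos s ⟨hs.1, hs.2.le.trans ht.2⟩) (Real.exp_pos _)) ht.1
  have hb := (hb_diff t ht).hasDerivWithinAt
  have hu : UniqueDiffWithinAt ℝ (Ioc 0 T) t := uniqueDiffOn_Ioc 0 T t ht
  have hE : HasDerivWithinAt (fun s => Real.exp (2 * k * s))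
      (Real.exp (2 * k * t) * (2 * k * 1)) (Ioc 0 T) t :=
    (((hasDerivAt_id t).const_mul (2 * k)).exp).hasDerivWithinAt
  have hE0 := Real.exp_pos (2 * k * t)
  have hβ' := (((hasDerivWithinAt_const t (Ioc 0 T) (2 * k)).fun_div (hb.fun_mul hE)
    (mul_pos hbt hE0).ne').fun_mul hI).const_sub 1
  have hlam' := hb.rpow_const (p := 1 - δ) (Or.inl hbt.ne')
  rw [← funext hβ] at hβ'
  rw [← funext hlam] at hlam'
  have hb't := hb'_pos t ht
  refine ⟨?_, mul_pos (pow_pos hδ.1 2) (div_pos hb't hbt)⟩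
  rw [hβ'.derivWithin hu, hlam'.derivWithin hu, hβ t, hlam t,
    Real.rpow_sub_one hbt.ne' (1 - δ)]
  have hL := Real.rpow_pos_of_pos hbt (1 - δ)
  generalize b t ^ (1 - δ) = L at *
  generalize (∫ s in (0:ℝ)..t, b s * Real.exp (2 * k * s)) = I at *
  generalize Real.exp (2 * k * t) = E at *
  generalize derivWithin b (Ioc 0 T) t = b' at *
  generalize b t = B at *
  rw [sub_sub_cancel]
  field_simp
  ring
end

section
/- Let $k>0$, $\theta>0$, $T>0$, and set $b(t)=(1+\theta kt)\,t^{\frac{2}{\theta}-1}$ for $t\in(0,T]$. Then $b$ satisfies both conditions (C1): $\lim_{t\to 0^+}b(t)=0$ and $b'(t)>0$ for all $t\in(0,T]$, and (C2): $\frac{b'^2}{b}\in L^1([0,T])$, if and only if $\theta\in(0,1)$. -/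
open Real Set Filter MeasureTheory

theorem hasDerivAt_affine_mul_rpow (c p : ℝ) {t : ℝ} (ht : 0 < t) :
    HasDerivAt (fun t : ℝ => (1 + c * t) * t ^ p) ((p + c * (p + 1) * t) * t ^ (p - 1)) t := by
  have h₁ : HasDerivAt (fun t : ℝ => 1 + c * t) c t := by
    simpa using ((hasDerivAt_id t).const_mul c).const_add 1
  refine (h₁.mul (Real.hasDerivAt_rpow_const (p := p) (Or.inl ht.ne'))).congr_deriv ?_
  have h : t ^ p = t * t ^ (p - 1) := by
    rw [Real.rpow_sub_one ht.ne']
    field_simp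
  rw [h]
  ring

theorem sq_mul_rpow_div_mul_rpow (u v p : ℝ) {t : ℝ} (ht : 0 < t) :
    (u * t ^ (p - 1)) ^ 2 / (v * t ^ p) = t ^ (p - 2) * (u ^ 2 / v) := by
  have hp : 0 < t ^ p := Real.rpow_pos_of_pos ht p
  rw [Real.rpow_sub_one ht.ne', Real.rpow_sub ht, Real.rpow_two]
  by_cases hv : v = 0
  · simp [hv]
  · field_simp

theorem integrableOn_Ioc_rpow_iff {s T : ℝ} (hT : 0 < T) :
    IntegrableOn (fun t : ℝ => t ^ s) (Ioc 0 T) ↔ -1 < s := by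
  rw [integrableOn_Ioc_iff_integrableOn_Ioo, intervalIntegral.integrableOn_Ioo_rpow_iff hT]

theorem MeasureTheory.IntegrableOn.mul_continuousOn_Icc {f g : ℝ → ℝ} {a b : ℝ}
    (hf : IntegrableOn f (Ioc a b)) (hg : ContinuousOn g (Icc a b)) :
    IntegrableOn (fun t => f t * g t) (Ioc a b) := by
  rw [← integrableOn_Icc_iff_integrableOn_Ioc] at hf ⊢
  exact hf.mul_continuousOn hg isCompact_Icc

theorem integrableOn_rpow_mul_sq_div_iff {s p q c T : ℝ} (hT : 0 < T) (hp : 0 < p) (hq : 0 ≤ q)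
    (hc : 0 ≤ c) :
    IntegrableOn (fun t : ℝ => t ^ s * ((p + q * t) ^ 2 / (1 + c * t))) (Ioc 0 T) ↔ -1 < s := by
  have hu : ∀ t ∈ Icc (0 : ℝ) T, 0 < p + q * t := fun t ht =>
    add_pos_of_pos_of_nonneg hp (mul_nonneg hq ht.1)
  have hv : ∀ t ∈ Icc (0 : ℝ) T, 0 < 1 + c * t := fun t ht =>
    add_pos_of_pos_of_nonneg one_pos (mul_nonneg hc ht.1)
  rw [← integrableOn_Ioc_rpow_iff hT]
  constructor
  · intro h
    have hg : ContinuousOn (fun t : ℝ => (1 + c * t) / (p + q * t) ^ 2) (Icc 0 T) :=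
      ContinuousOn.div (by fun_prop) (by fun_prop) fun t ht => (pow_pos (hu t ht) 2).ne'
    refine (h.mul_continuousOn_Icc hg).congr_fun (fun t ht => ?_) measurableSet_Ioc
    have h₁ := (hu t (Ioc_subset_Icc_self ht)).ne'
    have h₂ := (hv t (Ioc_subset_Icc_self ht)).ne'
    change t ^ s * ((p + q * t) ^ 2 / (1 + c * t)) * ((1 + c * t) / (p + q * t) ^ 2) = t ^ s
    rw [mul_assoc, div_mul_div_cancel₀ h₂, div_self (pow_ne_zero 2 h₁), mul_one]
  · intro h
    exact h.mul_continuousOn_Icc <|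
      ContinuousOn.div (by fun_prop) (by fun_prop) fun t ht => (hv t ht).ne'

theorem tendsto_affine_mul_rpow_zero_iff {c p : ℝ} (hc : 0 ≤ c) :
    Tendsto (fun t : ℝ => (1 + c * t) * t ^ p) (nhdsWithin 0 (Ioi 0)) (nhds 0) ↔ 0 < p := by
  constructor
  · intro h
    by_contra! hp
    have hlt := h.eventually (gt_mem_nhds one_pos)
    have hmem : Ioo (0 : ℝ) 1 ∈ nhdsWithin 0 (Ioi 0) := Ioo_mem_nhdsGT one_pos
    obtain ⟨t, ht, ht'⟩ := (hlt.and hmem).exists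
    have h₁ : 1 ≤ t ^ p := Real.one_le_rpow_of_pos_of_le_one_of_nonpos ht'.1 ht'.2.le hp
    nlinarith [mul_nonneg hc ht'.1.le]
  · intro hp
    have h : ContinuousAt (fun t : ℝ => (1 + c * t) * t ^ p) 0 :=
      ContinuousAt.mul (by fun_prop) (Real.continuousAt_rpow_const 0 p (Or.inr hp.le))
    have h₀ := h.tendsto
    simp only [Real.zero_rpow hp.ne', mul_zero] at h₀
    exact h₀.mono_left nhdsWithin_le_nhds

/-- For `b(t) = (1+θkt) t^{2/θ-1}` with `θ > 0`, `b` satisfies both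
(C1): `b(0⁺)=0` and `b' > 0` on `(0,T]`, and (C2): `b'²/b ∈ L¹([0,T])`,
if and only if `θ ∈ (0,1)`. -/
theorem power_b_satisfies_C1_C2_iff (k θ T : ℝ) (hk : 0 < k) (hθ : 0 < θ) (hT : 0 < T)
    (b : ℝ → ℝ) (hb : ∀ t, b t = (1 + θ * k * t) * t ^ (2 / θ - 1)) :
    ((Tendsto b (nhdsWithin 0 (Ioi 0)) (nhds 0) ∧ ∀ t ∈ Ioc (0:ℝ) T, 0 < deriv b t) ∧
        IntegrableOn (fun t => (deriv b t) ^ 2 / b t) (Ioc (0:ℝ) T))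
      ↔ θ ∈ Ioo (0:ℝ) 1 := by
  obtain rfl : b = fun t => (1 + θ * k * t) * t ^ (2 / θ - 1) := funext hb
  have hθ₁ : θ < 1 ↔ 1 < 2 / θ - 1 := by
    rw [lt_sub_iff_add_lt, lt_div_iff₀ hθ]
    constructor <;> intro h <;> linarith
  have hp₁ : 0 < 2 / θ - 1 + 1 := by
    rw [sub_add_cancel]
    positivity
  clear hb
  generalize 2 / θ - 1 = p at *
  have hc : 0 < θ * k := mul_pos hθ hk
  have hderiv : ∀ t ∈ Ioc (0 : ℝ) T, deriv (fun t : ℝ => (1 + θ * k * t) * t ^ p) t =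
      (p + θ * k * (p + 1) * t) * t ^ (p - 1) := fun t ht =>
    (hasDerivAt_affine_mul_rpow (θ * k) p ht.1).deriv
  have hq : 0 < θ * k * (p + 1) := mul_pos hc hp₁
  rw [tendsto_affine_mul_rpow_zero_iff hc.le, mem_Ioo, and_iff_right hθ, hθ₁,
    integrableOn_congr_fun (fun t ht => by
      rw [hderiv t ht, sq_mul_rpow_div_mul_rpow _ _ _ ht.1]) measurableSet_Ioc]
  constructor
  · rintro ⟨⟨hp, -⟩, hint⟩
    rw [integrableOn_rpow_mul_sq_div_iff hT hp hq.le hc.le] at hint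
    linarith
  · intro hp
    have hp₀ : 0 < p := one_pos.trans hp
    refine ⟨⟨hp₀, fun t ht => ?_⟩, ?_⟩
    · rw [hderiv t ht]
      have := ht.1
      positivity
    · rw [integrableOn_rpow_mul_sq_div_iff hT hp₀ hq.le hc.le]
      linarith
end

section
/- Let $k>0$, $T>0$, and set $b(t)=\sinh^2(kt)+\cosh(kt)\sinh(kt)-kt$ for $t\in(0,T]$. Then $b$ satisfies: (C1) $\lim_{t\to 0^+}b(t)=0$ and $b'(t)>0$ for all $t\in(0,T]$; (C2) $\frac{b'^2}{b}\in L^1([0,T])$; (C3) there exists $\delta\in(0,1)$ such that $t\mapsto \frac{b'(t)}{b(t)^{\delta}}$ is bounded from above on $(0,T]$; and (C4) $t\mapsto \frac{b'(t)\int_0^t b(s)\,ds}{b(t)^2}$ is bounded from above on $(0,T]$. -/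
open Real Set Filter MeasureTheory

lemma sinh_sq_add_cosh_mul_sinh_sub (x : ℝ) :
    sinh x ^ 2 + cosh x * sinh x - x = (exp (2 * x) - 1) / 2 - x := by
  have h1 : exp (2 * x) = exp x * exp x := by rw [← exp_add]; ring_nf
  have h2 : exp x * exp (-x) = 1 := by rw [← exp_add]; simp
  rw [sinh_eq, cosh_eq, h1]
  linear_combination (-1 / 2) * h2

lemma exp_sub_one_le_mul_exp (u : ℝ) : exp u - 1 ≤ u * exp u := by
  have h1 : exp u * exp (-u) = 1 := by rw [← exp_add]; simp
  nlinarith [add_one_le_exp (-u), exp_pos u]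

/-- For `b(t) = sinh²(kt) + cosh(kt)sinh(kt) - kt`, `b` satisfies
(C1): `b(0⁺)=0` and `b' > 0` on `(0,T]`; (C2): `b'²/b ∈ L¹([0,T])`;
(C3): there is `δ ∈ (0,1)` with `b'/b^δ` bounded from above on `(0,T]`; and
(C4): `b' ∫₀ᵗ b / b²` is bounded from above on `(0,T]`. -/
theorem sinh_b_satisfies_C1_C2_C3_C4 (k T : ℝ) (hk : 0 < k) (hT : 0 < T)
    (b : ℝ → ℝ)
    (hb : ∀ t, b t = Real.sinh (k * t) ^ 2 + Real.cosh (k * t) * Real.sinh (k * t) - k * t) :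
    (Tendsto b (nhdsWithin 0 (Ioi 0)) (nhds 0) ∧ ∀ t ∈ Ioc (0:ℝ) T, 0 < deriv b t) ∧
    IntegrableOn (fun t => (deriv b t) ^ 2 / b t) (Ioc (0:ℝ) T) ∧
    (∃ δ ∈ Ioo (0:ℝ) 1, ∃ C : ℝ, ∀ t ∈ Ioc (0:ℝ) T, deriv b t / b t ^ δ ≤ C) ∧
    (∃ C : ℝ, ∀ t ∈ Ioc (0:ℝ) T,
      deriv b t * (∫ s in (0:ℝ)..t, b s) / (b t) ^ 2 ≤ C) := by
  have hbe : b = fun t => (exp (2 * (k * t)) - 1) / 2 - k * t :=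
    funext fun t => (hb t).trans (sinh_sq_add_cosh_mul_sinh_sub (k * t))
  have hcont : Continuous b := by rw [hbe]; fun_prop
  have hder (t : ℝ) : HasDerivAt b (k * (exp (2 * (k * t)) - 1)) t := by
    have hlin : HasDerivAt (fun t => k * t) k t := by
      simpa using (hasDerivAt_id t).const_mul k
    rw [hbe]
    exact (((((hlin.const_mul 2).exp).sub_const 1).div_const 2).fun_sub hlin).congr_deriv (by ring)
  have hderiv : deriv b = fun t => k * (exp (2 * (k * t)) - 1) := funext fun t => (hder t).deriv
  have hderiv_pos (t : ℝ) (ht : t ∈ Ioc 0 T) : 0 < deriv b t := by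
    have h : 0 < k * t := mul_pos hk ht.1
    rw [hderiv]
    exact mul_pos hk (sub_pos.2 (one_lt_exp_iff.2 (by linarith)))
  have hlower (t : ℝ) (ht : t ∈ Ioc 0 T) : (k * t) ^ 2 ≤ b t := by
    have h : 0 < k * t := mul_pos hk ht.1
    have := quadratic_le_exp_of_nonneg (x := 2 * (k * t)) (by linarith)
    simp only [hbe]
    nlinarith
  have hpos (t : ℝ) (ht : t ∈ Ioc 0 T) : 0 < b t :=
    (pow_pos (mul_pos hk ht.1) 2).trans_le (hlower t ht)
  set M := exp (2 * (k * T)) with hM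
  have hM0 : 0 < M := exp_pos _
  have hupper (t : ℝ) (ht : t ∈ Ioc 0 T) : deriv b t ≤ 2 * k * M * (k * t) := by
    have h : 0 < k * t := mul_pos hk ht.1
    have hle : exp (2 * (k * t)) ≤ M :=
      exp_le_exp.2 (by have := mul_le_mul_of_nonneg_left ht.2 hk.le; linarith)
    rw [hderiv]
    calc k * (exp (2 * (k * t)) - 1) ≤ k * (2 * (k * t) * exp (2 * (k * t))) := by
          gcongr
          exact exp_sub_one_le_mul_exp _
      _ ≤ k * (2 * (k * t) * M) := by gcongr
      _ = 2 * k * M * (k * t) := by ring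
  refine ⟨⟨?_, hderiv_pos⟩, ?_, ⟨1 / 2, by norm_num, 2 * k * M, fun t ht => ?_⟩,
    2 * M, fun t ht => ?_⟩
  · have h0 : b 0 = 0 := by simp [hb]
    simpa only [h0] using (hcont.tendsto 0).mono_left nhdsWithin_le_nhds
  · refine Measure.integrableOn_of_bounded (M := (2 * k * M) ^ 2) measure_Ioc_lt_top.ne ?_ ?_
    · exact (((measurable_deriv b).pow_const 2).div hcont.measurable).aestronglyMeasurable
    · refine (ae_restrict_iff' measurableSet_Ioc).2 (ae_of_all _ fun t ht => ?_)
      have hb0 := hpos t ht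
      rw [norm_of_nonneg (by positivity), div_le_iff₀ hb0]
      calc deriv b t ^ 2 ≤ (2 * k * M * (k * t)) ^ 2 :=
            pow_le_pow_left₀ (hderiv_pos t ht).le (hupper t ht) 2
        _ = (2 * k * M) ^ 2 * (k * t) ^ 2 := by ring
        _ ≤ (2 * k * M) ^ 2 * b t := by gcongr; exact hlower t ht
  · rw [← sqrt_eq_rpow, div_le_iff₀ (sqrt_pos.2 (hpos t ht))]
    refine (hupper t ht).trans ?_
    gcongr
    exact le_sqrt_of_sq_le (hlower t ht)
  · have hmono : MonotoneOn b (Icc 0 t) := by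
      refine monotoneOn_of_deriv_nonneg (convex_Icc 0 t) hcont.continuousOn
        (fun x _ => (hder x).differentiableAt.differentiableWithinAt) fun x hx => ?_
      rw [interior_Icc] at hx
      exact (hderiv_pos x ⟨hx.1, hx.2.le.trans ht.2⟩).le
    have hint : ∫ s in (0 : ℝ)..t, b s ≤ t * b t := by
      have := intervalIntegral.integral_mono_on (μ := volume) ht.1.le
        (hcont.intervalIntegrable 0 t) (intervalIntegrable_const (c := b t))
        fun x hx => hmono hx (right_mem_Icc.2 ht.1.le) hx.2
      simpa using this
    have hb0 := hpos t ht
    have ht0 := ht.1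
    rw [div_le_iff₀ (by positivity)]
    calc deriv b t * ∫ s in (0 : ℝ)..t, b s ≤ deriv b t * (t * b t) :=
          mul_le_mul_of_nonneg_left hint (hderiv_pos t ht).le
      _ ≤ 2 * k * M * (k * t) * (t * b t) := by gcongr; exact hupper t ht
      _ = 2 * M * ((k * t) ^ 2 * b t) := by ring
      _ ≤ 2 * M * (b t * b t) := by gcongr; exact hlower t ht
      _ = 2 * M * b t ^ 2 := by ring
end

section
/- Let $k>0$, $T>0$, and let $a\in C^1([0,T])$ satisfy (A1): $a(t)>0$ and $a'(t)>0$ for all $t\in(0,T]$; (A2): $a(0)=0$ and $\lim_{t\to 0^+}\frac{a(t)}{a'(t)}=0$; (A3): $\frac{a'^2}{a}\in L^1([0,T])$. Define $b(t)=a(t)+2k\int_0^t a(s)\,ds$. Then $b$ satisfies (C1): $\lim_{t\to 0^+}b(t)=0$ and $b'(t)>0$ for all $t\in(0,T]$, and (C2): $\frac{b'^2}{b}\in L^1([0,T])$; moreover $1-\frac{2k}{b(t)e^{2kt}}\int_0^t b(s)e^{2ks}\,ds=\frac{a(t)}{a(t)+2k\int_0^t a(s)\,ds}$ for all $t\in(0,T]$.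 -/
open Real Set Filter MeasureTheory

/-- The primitive of a function continuous on `[0,T]` is differentiable within `[0,T]`. -/
theorem hasDerivWithinAt_integral_Icc {a : ℝ → ℝ} {T t : ℝ} (ha : ContinuousOn a (Icc 0 T))
    (ht : t ∈ Icc 0 T) :
    HasDerivWithinAt (fun u => ∫ s in (0:ℝ)..u, a s) (a t) (Icc 0 T) t := by
  have : Fact (t ∈ Icc 0 T) := ⟨ht⟩
  refine intervalIntegral.integral_hasDerivWithinAt_right ?_
    (ha.stronglyMeasurableAtFilter_nhdsWithin measurableSet_Icc t) (ha t ht)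
  refine ContinuousOn.intervalIntegrable ?_
  rw [uIcc_of_le ht.1]
  exact ha.mono (Icc_subset_Icc_right ht.2)

/-- If `a ∈ C¹([0,T])` satisfies (A1): `a > 0` and `a' > 0` on `(0,T]`;
(A2): `a(0)=0` and `a/a' → 0` as `t → 0⁺`; (A3): `a'²/a ∈ L¹([0,T])`,
then `b(t) = a(t) + 2k∫₀ᵗ a(s) ds` satisfies (C1): `b(0⁺)=0` and `b' > 0` on `(0,T]`,
and (C2): `b'²/b ∈ L¹([0,T])`; moreover
`1 - (2k/(b(t)e^{2kt})) ∫₀ᵗ b(s)e^{2ks} ds = a(t)/(a(t) + 2k∫₀ᵗ a(s) ds)` on `(0,T]`. -/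
theorem b_from_a_satisfies_C1_C2 (k T : ℝ) (hk : 0 < k) (hT : 0 < T) (a b : ℝ → ℝ)
    (ha_diff : ∀ t ∈ Icc (0:ℝ) T, DifferentiableWithinAt ℝ a (Icc (0:ℝ) T) t)
    (ha_cont : ContinuousOn (derivWithin a (Icc (0:ℝ) T)) (Icc (0:ℝ) T))
    (hA1 : ∀ t ∈ Ioc (0:ℝ) T, 0 < a t ∧ 0 < derivWithin a (Icc (0:ℝ) T) t)
    (hA2 : a 0 = 0 ∧
      Tendsto (fun t => a t / derivWithin a (Icc (0:ℝ) T) t)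
        (nhdsWithin 0 (Ioi 0)) (nhds 0))
    (hA3 : IntegrableOn (fun t => (derivWithin a (Icc (0:ℝ) T) t) ^ 2 / a t) (Ioc (0:ℝ) T))
    (hb : ∀ t, b t = a t + 2 * k * ∫ s in (0:ℝ)..t, a s) :
    (Tendsto b (nhdsWithin 0 (Ioi 0)) (nhds 0) ∧
      ∀ t ∈ Ioc (0:ℝ) T, 0 < derivWithin b (Ioc (0:ℝ) T) t) ∧
    IntegrableOn (fun t => (derivWithin b (Ioc (0:ℝ) T) t) ^ 2 / b t) (Ioc (0:ℝ) T) ∧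
    ∀ t ∈ Ioc (0:ℝ) T,
      1 - (2 * k / (b t * Real.exp (2 * k * t))) *
          ∫ s in (0:ℝ)..t, b s * Real.exp (2 * k * s)
        = a t / (a t + 2 * k * ∫ s in (0:ℝ)..t, a s) := by
  have ha : ContinuousOn a (Icc 0 T) := fun t ht => (ha_diff t ht).continuousWithinAt
  set A : ℝ → ℝ := fun t => ∫ s in (0:ℝ)..t, a s with hA
  have hAd : ∀ t ∈ Icc 0 T, HasDerivWithinAt A (a t) (Icc 0 T) t :=
    fun t ht => hasDerivWithinAt_integral_Icc ha ht
  have hbA : b = fun t => a t + 2 * k * A t := funext hb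
  have hbd : ∀ t ∈ Icc 0 T,
      HasDerivWithinAt b (derivWithin a (Icc 0 T) t + 2 * k * a t) (Icc 0 T) t := by
    intro t ht
    rw [hbA]
    exact (ha_diff t ht).hasDerivWithinAt.add ((hAd t ht).const_mul _)
  have hbc : ContinuousOn b (Icc 0 T) := fun t ht => (hbd t ht).continuousWithinAt
  have hAc : ContinuousOn A (Icc 0 T) := fun t ht => (hAd t ht).continuousWithinAt
  have hbderiv : ∀ t ∈ Ioc 0 T,
      derivWithin b (Ioc 0 T) t = derivWithin a (Icc 0 T) t + 2 * k * a t := fun t ht =>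
    ((hbd t (Ioc_subset_Icc_self ht)).mono Ioc_subset_Icc_self).derivWithin
      (uniqueDiffOn_Ioc 0 T t ht)
  have hab : ∀ t ∈ Ioc 0 T, a t ≤ b t := by
    intro t ht
    have hA0 : 0 ≤ A t := by
      refine intervalIntegral.integral_nonneg ht.1.le fun u hu => ?_
      rcases hu.1.eq_or_lt with h | h
      · rw [← h, hA2.1]
      · exact (hA1 u ⟨h, hu.2.trans ht.2⟩).1.le
    have := mul_nonneg (mul_nonneg zero_le_two hk.le) hA0
    rw [hbA]
    linarith
  refine ⟨⟨?_, ?_⟩, ?_, ?_⟩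
  · have h0 : b 0 = 0 := by simp [hbA, hA, hA2.1]
    have h := hbc 0 (left_mem_Icc.2 hT.le)
    rw [ContinuousWithinAt, h0] at h
    rw [← nhdsWithin_Ioc_eq_nhdsGT hT]
    exact h.mono_left (nhdsWithin_mono _ Ioc_subset_Icc_self)
  · intro t ht
    rw [hbderiv t ht]
    have h := hA1 t ht
    have := h.1
    have := h.2
    positivity
  · have hdom : IntegrableOn (fun t => (derivWithin a (Icc 0 T) t) ^ 2 / a t +
        (4 * k * derivWithin a (Icc 0 T) t + 4 * k ^ 2 * a t)) (Ioc 0 T) := by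
      refine hA3.add (IntegrableOn.mono_set ?_ Ioc_subset_Icc_self)
      exact ((ha_cont.const_mul _).add (ha.const_mul _)).integrableOn_Icc
    have hcont : ContinuousOn
        (fun t => (derivWithin a (Icc 0 T) t + 2 * k * a t) ^ 2 / b t) (Ioc 0 T) := by
      refine ContinuousOn.div ?_ (hbc.mono Ioc_subset_Icc_self)
        fun t ht => ((hA1 t ht).1.trans_le (hab t ht)).ne'
      exact ((ha_cont.add (ha.const_mul _)).pow 2).mono Ioc_subset_Icc_self
    rw [integrableOn_congr_fun (fun t ht => by simp only [hbderiv t ht]) measurableSet_Ioc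
      (g := fun t => (derivWithin a (Icc 0 T) t + 2 * k * a t) ^ 2 / b t)]
    refine Integrable.mono' hdom (hcont.aestronglyMeasurable measurableSet_Ioc) ?_
    refine (ae_restrict_iff' measurableSet_Ioc).2 (Eventually.of_forall fun t ht => ?_)
    have hapos := (hA1 t ht).1
    have hbpos := hapos.trans_le (hab t ht)
    rw [Real.norm_of_nonneg (by positivity)]
    calc _ ≤ (derivWithin a (Icc 0 T) t + 2 * k * a t) ^ 2 / a t :=
          div_le_div_of_nonneg_left (sq_nonneg _) hapos (hab t ht)
      _ = _ := by
          field_simp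
          ring
  · intro t ht
    have hsub : Icc 0 t ⊆ Icc 0 T := Icc_subset_Icc_right ht.2
    have hexp : Continuous fun s : ℝ => Real.exp (2 * k * s) := by fun_prop
    have hint : ∫ s in (0:ℝ)..t, b s * Real.exp (2 * k * s) = A t * Real.exp (2 * k * t) := by
      rw [intervalIntegral.integral_eq_sub_of_hasDerivAt_of_le ht.1.le
        (f := fun s => A s * Real.exp (2 * k * s)) ((hAc.mono hsub).mul hexp.continuousOn)]
      · simp [hA]
      · intro x hx
        have hA' : HasDerivAt A (a x) x := (hAd x (hsub (Ioo_subset_Icc_self hx))).hasDerivAt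
          (Icc_mem_nhds hx.1 (hx.2.trans_le ht.2))
        have hE : HasDerivAt (fun s => Real.exp (2 * k * s))
            (Real.exp (2 * k * x) * (2 * k)) x := by
          simpa using ((hasDerivAt_id x).const_mul (2 * k)).exp
        refine (hA'.mul hE).congr_deriv ?_
        rw [hbA]
        ring
      · refine ContinuousOn.intervalIntegrable ?_
        rw [uIcc_of_le ht.1.le]
        exact (hbc.mono hsub).mul hexp.continuousOn
    have hbpos := (hA1 t ht).1.trans_le (hab t ht)
    have hbt : b t = a t + 2 * k * A t := hb t
    rw [hint, ← hb t]
    have hE := (Real.exp_pos (2 * k * t)).ne'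
    field_simp
    linarith
end
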